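/- Closed form of Ando's BPIC bias-correction term in the normal–normal model: define J_n(μ) = −(1/n) Σ_{i=1}^n (d²/dμ²)[ log φ(y_i; μ, σ_A²) + (1/n) log φ(μ; μ₀, τ₀²) ] and I_n^A(μ) = (1/n) Σ_{i=1}^n ( (d/dμ)[ log φ(y_i; μ, σ_A²) + (1/n) log φ(μ; μ₀, τ₀²) ] )². Then the quantity BC₁ := (1/n) [ ∫_ℝ ( log φ(μ; μ₀, τ₀²) + Σ_{i=1}^n log φ(y_i; μ, σ_A²) ) dN(μ̂, σ̂²)(μ) − ( log φ(μ̂; μ₀, τ₀²) + Σ_{i=1}^n log φ(y_i; μ̂, σ_A²) ) + J_n(μ̂)^{−1} I_n^A(μ̂) + 1/2 ] equals (σ̂²/n) · Σ_{i=1}^n ( (μ₀ − μ̂)/(n τ₀²) + (y_i − μ̂)/σ_A² )². -/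

import Mathlib

open MeasureTheory ProbabilityTheory Real

/-- Density of the normal distribution `N(m, s2)` evaluated at `x`. -/
noncomputable def normalPdf (x m s2 : ℝ) : ℝ :=
  (Real.sqrt (2 * Real.pi * s2))⁻¹ * Real.exp (-(x - m) ^ 2 / (2 * s2))

theorem log_normalPdf (x m : ℝ) {s2 : ℝ} (hs : 0 < s2) :
    Real.log (normalPdf x m s2) =
      -Real.log (Real.sqrt (2 * Real.pi * s2)) - (x - m) ^ 2 / (2 * s2) := by
  rw [normalPdf, Real.log_mul (by positivity) (Real.exp_pos _).ne', Real.log_inv, Real.log_exp]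
  ring

theorem hasDerivAt_log_normalPdf_mean (x m : ℝ) {s2 : ℝ} (hs : 0 < s2) :
    HasDerivAt (fun μ => Real.log (normalPdf x μ s2)) ((x - m) / s2) m := by
  simp only [log_normalPdf _ _ hs]
  refine (((((hasDerivAt_id' m).const_sub x).pow 2).div_const (2 * s2)).const_sub
    (-Real.log (Real.sqrt (2 * Real.pi * s2)))).congr_deriv ?_
  field_simp
  simp [mul_comm]

theorem normalPdf_comm (x m s2 : ℝ) : normalPdf x m s2 = normalPdf m x s2 := by
  rw [normalPdf, normalPdf, ← neg_sub m x, neg_sq]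

theorem integral_sq_sub_mean_gaussianReal (m : ℝ) (v : NNReal) :
    ∫ x, (x - m) ^ 2 ∂(gaussianReal m v) = v := by
  have h := variance_eq_integral (μ := gaussianReal m v) (X := fun x : ℝ => x) (by fun_prop)
  rw [variance_fun_id_gaussianReal, integral_id_gaussianReal] at h
  exact h.symm

theorem integrable_sq_sub_gaussianReal (c m : ℝ) (v : NNReal) :
    Integrable (fun x : ℝ => (x - c) ^ 2) (gaussianReal m v) :=
  ((memLp_id_gaussianReal' 2 (by simp)).sub (memLp_const c)).integrable_sq

/-- The log posterior kernel is its value at the posterior mean `m` minus `(x - m)² / (2v)`. -/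
theorem log_normalPdf_add_sum_eq {a t : ℝ} (ha : 0 < a) (ht : 0 < t) (μ0 : ℝ) {n : ℕ}
    (y : Fin n → ℝ) {v m : ℝ} (hv : v = (1 / t + n / a)⁻¹)
    (hm : m = v * (μ0 / t + ∑ i, y i / a)) (x : ℝ) :
    Real.log (normalPdf x μ0 t) + ∑ i, Real.log (normalPdf (y i) x a) =
      Real.log (normalPdf m μ0 t) + ∑ i, Real.log (normalPdf (y i) m a)
        - (x - m) ^ 2 / (2 * v) := by
  have hvi : 1 / v = 1 / t + n / a := by rw [hv, one_div, inv_inv]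
  have hS : ∑ i, y i / a = m * (1 / t + n / a) - μ0 / t := by
    rw [hm, hv]; field_simp; ring
  have hsum : ∀ z, ∑ i, Real.log (normalPdf (y i) z a) =
      ∑ i, (-Real.log (Real.sqrt (2 * Real.pi * a)) - y i ^ 2 / (2 * a))
        + z * ∑ i, y i / a - n / a * (z ^ 2 / 2) := by
    intro z
    have hc : (n : ℝ) / a * (z ^ 2 / 2) = ∑ _i : Fin n, z ^ 2 / (2 * a) := by
      simp; ring
    rw [hc, Finset.mul_sum, ← Finset.sum_add_distrib, ← Finset.sum_sub_distrib]
    refine Finset.sum_congr rfl fun i _ => ?_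
    rw [log_normalPdf _ _ ha]
    ring
  have hq : (x - m) ^ 2 / (2 * v) = (x - m) ^ 2 / 2 * (1 / t + n / a) := by
    rw [← hvi]; ring
  rw [hsum, hsum, hS, hq, log_normalPdf _ _ ht, log_normalPdf _ _ ht]
  ring

/-- Closed form of Ando's BPIC bias-correction term in the normal–normal model:
`BC₁ = (σ̂²/n) ∑ᵢ ((μ₀ − μ̂)/(n τ₀²) + (yᵢ − μ̂)/σ_A²)²`. -/
theorem bpic_bias_correction_closed_form
    (σA τ0 μ0 : ℝ) (hσA : 0 < σA) (hτ0 : 0 < τ0)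
    (n : ℕ) (hn : 1 ≤ n) (y : Fin n → ℝ)
    (σhat2 μhat : ℝ)
    (hσhat2 : σhat2 = (1 / τ0 ^ 2 + n / σA ^ 2)⁻¹)
    (hμhat : μhat = σhat2 * (μ0 / τ0 ^ 2 + ∑ i, y i / σA ^ 2))
    (h : Fin n → ℝ → ℝ)
    (hh : h = fun i μ => Real.log (normalPdf (y i) μ (σA ^ 2))
      + (1 / (n : ℝ)) * Real.log (normalPdf μ μ0 (τ0 ^ 2)))
    (Jn InA : ℝ → ℝ)
    (hJn : Jn = fun μ => -(1 / (n : ℝ)) * ∑ i, deriv (deriv (h i)) μ)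
    (hInA : InA = fun μ => (1 / (n : ℝ)) * ∑ i, (deriv (h i) μ) ^ 2)
    (BC1 : ℝ)
    (hBC1 : BC1 = (1 / (n : ℝ)) *
      ((∫ μ, (Real.log (normalPdf μ μ0 (τ0 ^ 2))
            + ∑ i, Real.log (normalPdf (y i) μ (σA ^ 2)))
          ∂(gaussianReal μhat σhat2.toNNReal))
        - (Real.log (normalPdf μhat μ0 (τ0 ^ 2))
            + ∑ i, Real.log (normalPdf (y i) μhat (σA ^ 2)))
        + (Jn μhat)⁻¹ * InA μhat + 1 / 2)) :
    BC1 = (σhat2 / (n : ℝ)) *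
      ∑ i, ((μ0 - μhat) / ((n : ℝ) * τ0 ^ 2) + (y i - μhat) / σA ^ 2) ^ 2 := by
  have ha : 0 < σA ^ 2 := by positivity
  have ht : 0 < τ0 ^ 2 := by positivity
  have hv : 0 < σhat2 := by rw [hσhat2]; positivity
  have hd : ∀ i, deriv (h i) =
      fun μ => (μ0 - μ) / ((n : ℝ) * τ0 ^ 2) + (y i - μ) / σA ^ 2 := by
    intro i
    funext μ
    have hprior := hasDerivAt_log_normalPdf_mean μ0 μ ht
    simp only [normalPdf_comm μ0] at hprior
    rw [hh]
    refine ((hasDerivAt_log_normalPdf_mean (y i) μ ha).add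
      (hprior.const_mul (1 / (n : ℝ)))).deriv.trans ?_
    field_simp
    ring
  have hdd : ∀ i μ, deriv (deriv (h i)) μ = -(1 / ((n : ℝ) * τ0 ^ 2) + 1 / σA ^ 2) := by
    intro i μ
    rw [hd]
    refine ((((hasDerivAt_id' μ).const_sub μ0).div_const ((n : ℝ) * τ0 ^ 2)).add
      (((hasDerivAt_id' μ).const_sub (y i)).div_const (σA ^ 2))).deriv.trans ?_
    ring
  have hJ : (Jn μhat)⁻¹ = n * σhat2 := by
    rw [hJn, hσhat2]
    simp only [hdd, Finset.sum_const, Finset.card_univ, Fintype.card_fin, nsmul_eq_mul]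
    field_simp
  have hint := integral_sub (integrable_const (μ := gaussianReal μhat σhat2.toNNReal)
      (Real.log (normalPdf μhat μ0 (τ0 ^ 2)) + ∑ i, Real.log (normalPdf (y i) μhat (σA ^ 2))))
    ((integrable_sq_sub_gaussianReal μhat μhat σhat2.toNNReal).div_const (2 * σhat2))
  rw [integral_div, integral_sq_sub_mean_gaussianReal, Real.coe_toNNReal _ hv.le] at hint
  rw [hBC1, integral_congr_ae (Filter.Eventually.of_forall
    (log_normalPdf_add_sum_eq ha ht μ0 y hσhat2 hμhat)), hint, hJ, hInA]
  simp only [hd, integral_const, probReal_univ, one_smul]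
  field_simp
  ring
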